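/- arXiv:1512.03246 — 6 statements merged into one kernel-verified Lean document; each statement's English description precedes it below -/
import Mathlib

section
/- Let G = (V₀ ⊎ V₁, E, p) be a parity game, let B ⊆ V be such that the sub-game G' = G − B is well-defined, and let i ∈ {0,1}. If the node set V \ B of G' is i-closed in G, then win_i(G') ⊆ win_i(G). -/
universe u

/-- A parity game on an ambient vertex type `V`: a finite set of nodes, an owner
(player `0` or `1`) for each node, a directed edge relation between nodes, and a
priority function. -/
structure ParityGame (V : Type u) where
  nodes : Set V
  finite : nodes.Finite
  owner : V → Fin 2
  edge : V → V → Prop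
  edge_mem : ∀ u v, edge u v → u ∈ nodes ∧ v ∈ nodes
  priority : V → ℕ

namespace ParityGame

variable {V : Type u}

/-- Every node has at least one outgoing edge. -/
def Proper (G : ParityGame V) : Prop := ∀ u ∈ G.nodes, ∃ v, G.edge u v

/-- The game is bipartite: every edge goes between nodes of the two different players. -/
def Bipartite (G : ParityGame V) : Prop := ∀ u v, G.edge u v → G.owner u ≠ G.owner v

/-- The opponent `¬i = 1 - i` of player `i`. -/
def other (i : Fin 2) : Fin 2 := 1 - i

/-- The set `V_i` of nodes owned by player `i`. -/
def playerNodes (G : ParityGame V) (i : Fin 2) : Set V := {v | v ∈ G.nodes ∧ G.owner v = i}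

/-- An infinite play: consecutive positions are joined by edges. -/
def IsPlay (G : ParityGame V) (f : ℕ → V) : Prop := ∀ n, G.edge (f n) (f (n + 1))

/-- A (history-dependent) strategy: given the history of previously visited nodes and
the current node, it returns the next node. -/
def Strategy (V : Type u) := List V → V → V

/-- A strategy for player `i` is valid if at every node owned by player `i` it chooses
an outgoing edge. -/
def ValidStrategy (G : ParityGame V) (i : Fin 2) (σ : Strategy V) : Prop :=
  ∀ (h : List V) (u : V), u ∈ G.nodes → G.owner u = i → G.edge u (σ h u)

/-- The play `f` is consistent with the strategy `σ` of player `i`. -/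
def Consistent (G : ParityGame V) (i : Fin 2) (σ : Strategy V) (f : ℕ → V) : Prop :=
  ∀ n, G.owner (f n) = i → f (n + 1) = σ (List.ofFn fun k : Fin n => f k.1) (f n)

/-- `P` holds infinitely often. -/
def InfOften (P : ℕ → Prop) : Prop := ∀ N, ∃ n, N ≤ n ∧ P n

/-- Player `i` wins the play `f` if the largest priority occurring infinitely often
on `f` has parity `i`. -/
def WinsPlay (G : ParityGame V) (i : Fin 2) (f : ℕ → V) : Prop :=
  ∃ q, InfOften (fun n => G.priority (f n) = q) ∧
    (∀ q', InfOften (fun n => G.priority (f n) = q') → q' ≤ q) ∧ q % 2 = i.1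

/-- Player `i` has a winning strategy from node `v`. -/
def WinsFrom (G : ParityGame V) (i : Fin 2) (v : V) : Prop :=
  ∃ σ : Strategy V, ValidStrategy G i σ ∧
    ∀ f : ℕ → V, f 0 = v → IsPlay G f → Consistent G i σ f → WinsPlay G i f

/-- The winning set of player `i`. -/
def winSet (G : ParityGame V) (i : Fin 2) : Set V := {v | v ∈ G.nodes ∧ WinsFrom G i v}

/-- A set `B` of nodes is `i`-closed: player `i` can stay inside `B` and
player `¬i` cannot leave `B`. -/
def IClosed (G : ParityGame V) (i : Fin 2) (B : Set V) : Prop :=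
  B ⊆ G.nodes ∧ ∀ u ∈ B,
    (G.owner u = i → ∃ w, G.edge u w ∧ w ∈ B) ∧
    (G.owner u = other i → ∀ w, G.edge u w → w ∈ B)

/-- The `i`-reachability set of `A`: the set `A` together with all nodes from which
player `i` has a strategy guaranteeing that the play enters `A` at least once. -/
def reach (G : ParityGame V) (i : Fin 2) (A : Set V) : Set V :=
  A ∪ {v | v ∈ G.nodes ∧ ∃ σ : Strategy V, ValidStrategy G i σ ∧
        ∀ f : ℕ → V, f 0 = v → IsPlay G f → Consistent G i σ f → ∃ n, f n ∈ A}

/-- An `i`-dominion: a set of nodes from each of which player `i` can win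
without the play ever leaving the set. -/
def IsDominion (G : ParityGame V) (i : Fin 2) (D : Set V) : Prop :=
  D ⊆ G.nodes ∧ ∃ σ : Strategy V, ValidStrategy G i σ ∧
    ∀ v ∈ D, ∀ f : ℕ → V, f 0 = v → IsPlay G f → Consistent G i σ f →
      WinsPlay G i f ∧ ∀ n, f n ∈ D

/-- The sub-game `G − B` obtained by removing the nodes of `B`. -/
def sub (G : ParityGame V) (B : Set V) : ParityGame V where
  nodes := G.nodes \ B
  finite := G.finite.subset Set.diff_subset
  owner := G.owner
  edge u v := G.edge u v ∧ u ∉ B ∧ v ∉ B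
  edge_mem := fun u v h =>
    ⟨⟨(G.edge_mem u v h.1).1, h.2.1⟩, ⟨(G.edge_mem u v h.1).2, h.2.2⟩⟩
  priority := G.priority

/-- The signed priority `p₁`: `p(v)` if `p(v)` is odd, `−p(v)` if `p(v)` is even. -/
def p1 (G : ParityGame V) (v : V) : ℤ :=
  if G.priority v % 2 = 1 then (G.priority v : ℤ) else -(G.priority v : ℤ)

end ParityGame
/-- If the sub-game `G − B` is well-defined and its node set `V \ B`
is `i`-closed in `G`, then `win_i(G − B) ⊆ win_i(G)`. -/
theorem winSet_sub_subset {V : Type} (G : ParityGame V) (hG : G.Proper) (B : Set V)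
    (hwd : (G.sub B).Proper) (i : Fin 2) (hclosed : G.IClosed i (G.nodes \ B)) :
    (G.sub B).winSet i ⊆ G.winSet i := by
  classical
  rintro v ⟨hv, σ, hσ, hwin⟩
  choose! next hnext using hG
  refine ⟨hv.1, fun h u => if u ∈ G.nodes \ B then σ h u else next u, ?_, ?_⟩
  · intro h u hu hi
    by_cases hB : u ∈ G.nodes \ B
    · simpa only [if_pos hB] using (hσ h u hB hi).1
    · simpa only [if_neg hB] using hnext u hu
  · intro f hf0 hplay hcons
    have hmem : ∀ n, f n ∈ G.nodes \ B := by
      intro n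
      induction n with
      | zero => exact hf0 ▸ hv
      | succ n ih =>
        by_cases hi : G.owner (f n) = i
        · have hstep := hcons n hi
          simp only [if_pos ih] at hstep
          rw [hstep]
          exact ((G.sub B).edge_mem _ _ (hσ _ _ ih hi)).2
        · have hother : G.owner (f n) = ParityGame.other i := by
            unfold ParityGame.other
            omega
          exact (hclosed.2 _ ih).2 hother _ (hplay n)
    refine hwin f hf0 (fun n => ⟨hplay n, (hmem n).2, (hmem (n + 1)).2⟩) fun n hi => ?_
    have hstep := hcons n hi
    simpa only [if_pos (hmem n)] using hstep
end

section
/- Let G = (V₀ ⊎ V₁, E, p) be a parity game and i ∈ {0,1}. If U ⊆ win_{¬i}(G) and U* = reach_{¬i}(U), then win_{¬i}(G) = U* ∪ win_{¬i}(G − U*) and win_i(G) = win_i(G − U*). -/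
universe u

namespace ParityGame

variable {V : Type u} {G : ParityGame V} {i : Fin 2} {W : (ℕ → V) → Prop} {v w : V}

theorem eq_other_iff {a i : Fin 2} : a = other i ↔ a ≠ i := by
  revert a i; decide

/-- Player `i` has a strategy from `v` all of whose plays satisfy `W`. -/
def Forces (G : ParityGame V) (i : Fin 2) (W : (ℕ → V) → Prop) (v : V) : Prop :=
  ∃ σ : Strategy V, ValidStrategy G i σ ∧
    ∀ f : ℕ → V, f 0 = v → IsPlay G f → Consistent G i σ f → W f

/-- The winning condition `W` holds of a play as soon as it holds of one of its suffixes. -/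
def SuffixClosed (W : (ℕ → V) → Prop) : Prop :=
  ∀ (f : ℕ → V) (n : ℕ), W (fun k => f (n + k)) → W f

theorem infOften_add_iff {P : ℕ → Prop} (n : ℕ) : InfOften (fun k => P (n + k)) ↔ InfOften P := by
  constructor
  · intro h N
    obtain ⟨k, hk, hP⟩ := h N
    exact ⟨n + k, by omega, hP⟩
  · intro h N
    obtain ⟨k, hk, hP⟩ := h (n + N)
    exact ⟨k - n, by omega, by simpa [show n + (k - n) = k by omega] using hP⟩

theorem suffixClosed_winsPlay (G : ParityGame V) (i : Fin 2) : SuffixClosed (WinsPlay G i) := by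
  rintro f n ⟨q, hq, hmax, hpar⟩
  exact ⟨q, (infOften_add_iff (P := fun k => G.priority (f k) = q) n).1 hq,
    fun q' hq' => hmax q' ((infOften_add_iff (P := fun k => G.priority (f k) = q') n).2 hq'), hpar⟩

theorem suffixClosed_hits (A : Set V) : SuffixClosed (fun f : ℕ → V => ∃ n, f n ∈ A) :=
  fun _ n ⟨k, hk⟩ => ⟨n + k, hk⟩

theorem not_winsPlay_other {f : ℕ → V} (h : WinsPlay G i f) : ¬ WinsPlay G (other i) f := by
  rintro ⟨q', hq', hmax', hpar'⟩
  obtain ⟨q, hq, hmax, hpar⟩ := h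
  obtain rfl : q = q' := le_antisymm (hmax' q hq) (hmax q' hq')
  exact eq_other_iff.1 (Fin.ext (hpar'.symm.trans hpar) : other i = i).symm rfl

theorem IsPlay.mem_nodes {f : ℕ → V} (hf : IsPlay G f) (n : ℕ) : f n ∈ G.nodes :=
  (G.edge_mem _ _ (hf n)).1

/-- Any choice of successors can be completed to a valid strategy. -/
theorem Proper.exists_strategy (hG : G.Proper) (i : Fin 2) (c : Strategy V) :
    ∃ σ : Strategy V, ValidStrategy G i σ ∧ ∀ h u, G.edge u (c h u) → σ h u = c h u := by
  classical
  refine ⟨fun h u => if G.edge u (c h u) then c h u else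
    if hu : u ∈ G.nodes then (hG u hu).choose else u, fun h u hu _ => ?_, fun h u he => if_pos he⟩
  dsimp only
  split_ifs with he
  · exact he
  · exact (hG u hu).choose_spec

theorem dropWhile_ofFn_add {p : V → Bool} {f : ℕ → V} {n : ℕ} (hlt : ∀ k < n, p (f k) = true)
    (hn : p (f n) = false) (k : ℕ) :
    (List.ofFn fun l : Fin (n + k) => f l).dropWhile p = List.ofFn fun l : Fin k => f (n + l) := by
  rw [List.ofFn_add, List.dropWhile_append_of_pos]
  · cases k with
    | zero => simp
    | succ k => simp [List.ofFn_succ, hn]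
  · intro a ha
    obtain ⟨l, rfl⟩ := (List.mem_ofFn' _ _).1 ha
    exact hlt _ l.2

/-- A strategy `σ` can be modified so that, once the play enters a set from which player `i`
can force `W`, player `i` does force `W`. -/
theorem exists_switch_strategy (hW : SuffixClosed W) {σ : Strategy V} (hσ : ValidStrategy G i σ)
    {T : Set V} (hT : ∀ w ∈ T, Forces G i W w) :
    ∃ σ' : Strategy V, ValidStrategy G i σ' ∧ ∀ f : ℕ → V, IsPlay G f → Consistent G i σ' f →
      W f ∨ Consistent G i σ f ∧ ∀ n, f n ∉ T := by
  classical
  have : Nonempty (Strategy V) := ⟨σ⟩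
  choose! τ hτ hτW using hT
  let p : V → Bool := fun a => decide (a ∉ T)
  refine ⟨fun h u => match h.dropWhile p with
    | [] => if u ∈ T then τ u [] u else σ h u
    | w :: t => τ w (w :: t) u, fun h u hu ho => ?_, fun f hf hc => ?_⟩
  · dsimp only
    split
    · split_ifs with huT
      · exact hτ u huT _ _ hu ho
      · exact hσ _ _ hu ho
    · next w t hd =>
      have hw : w ∈ T := by
        have := List.head_dropWhile_not p (l := h) (by simp [hd])
        simp only [hd, List.head_cons] at this
        simpa [p] using this
      exact hτ w hw _ _ hu ho
  · by_cases hex : ∃ n, f n ∈ T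
    · left
      let n := Nat.find hex
      have hn : f n ∈ T := Nat.find_spec hex
      have hdrop := dropWhile_ofFn_add (p := p) (f := f) (n := n)
        (fun k hk => by simpa [p] using Nat.find_min hex hk) (by simpa [p] using hn)
      refine hW f n (hτW (f n) hn _ rfl (fun k => hf (n + k)) fun k ho => ?_)
      have := hc (n + k) ho
      dsimp only at this
      rw [hdrop] at this
      cases k with
      | zero => simpa [hn] using this
      | succ k => simpa [List.ofFn_succ, add_assoc] using this
    · push Not at hex
      refine Or.inr ⟨fun n ho => ?_, hex⟩
      have := hc n ho
      have hd : (List.ofFn fun k : Fin n => f k).dropWhile p = [] := by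
        rw [List.dropWhile_eq_nil_iff]
        intro a ha
        obtain ⟨l, rfl⟩ := (List.mem_ofFn' _ _).1 ha
        simpa [p] using hex l
      dsimp only at this
      rw [hd] at this
      simpa [hex n] using this

theorem Forces.of_edge (hG : G.Proper) (hW : SuffixClosed W) (ho : G.owner v = i)
    (he : G.edge v w) (hw : Forces G i W w) : Forces G i W v := by
  obtain ⟨σ, hσ, hσw⟩ := hG.exists_strategy i fun _ _ => w
  obtain ⟨σ', hσ', hf⟩ := exists_switch_strategy hW hσ (T := {w}) (by simpa using hw)
  refine ⟨σ', hσ', fun f h0 hp hc => (hf f hp hc).resolve_right fun ⟨hc', hT⟩ => hT 1 ?_⟩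
  subst h0
  exact (hc' 0 ho).trans (hσw _ _ he)

theorem Forces.of_forall_edge (hG : G.Proper) (hW : SuffixClosed W)
    (hw : ∀ w, G.edge v w → Forces G i W w) : Forces G i W v := by
  obtain ⟨σ, hσ, -⟩ := hG.exists_strategy i fun _ u => u
  obtain ⟨σ', hσ', hf⟩ := exists_switch_strategy hW hσ (T := {w | G.edge v w}) hw
  refine ⟨σ', hσ', fun f h0 hp hc => (hf f hp hc).resolve_right fun ⟨_, hT⟩ => hT 1 ?_⟩
  subst h0
  exact hp 0

/-- Two strategies of opposite players determine a play from every node. -/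
theorem exists_play {σ τ : Strategy V} (hσ : ValidStrategy G i σ)
    (hτ : ValidStrategy G (other i) τ) (hv : v ∈ G.nodes) :
    ∃ f : ℕ → V, f 0 = v ∧ IsPlay G f ∧ Consistent G i σ f ∧ Consistent G (other i) τ f := by
  classical
  let next : List V → V → V := fun h u => if G.owner u = i then σ h u else τ h u
  let s : ℕ → List V × V := fun n =>
    Nat.rec ([], v) (fun _ x => (x.1 ++ [x.2], next x.1 x.2)) n
  have hs : ∀ n, (s n).1 = List.ofFn fun k : Fin n => (s k).2 := by
    intro n
    induction n with
    | zero => rfl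
    | succ n ih =>
      rw [List.ofFn_succ', List.concat_eq_append]
      exact congrArg (· ++ [(s n).2]) ih
  have hnext : ∀ n, (s (n + 1)).2 = next (List.ofFn fun k : Fin n => (s k).2) (s n).2 :=
    fun n => congrArg (fun h => next h (s n).2) (hs n)
  have hedge : ∀ h u, u ∈ G.nodes → G.edge u (next h u) := by
    intro h u hu
    by_cases ho : G.owner u = i
    · simpa [next, ho] using hσ h u hu ho
    · simpa [next, ho] using hτ h u hu (eq_other_iff.2 ho)
  have hmem : ∀ n, (s n).2 ∈ G.nodes := by
    intro n
    induction n with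
    | zero => exact hv
    | succ n ih => exact (G.edge_mem _ _ (hedge (s n).1 _ ih)).2
  refine ⟨fun n => (s n).2, rfl, fun n => hedge (s n).1 _ (hmem n), fun n ho => ?_, fun n ho => ?_⟩
  · exact (hnext n).trans (if_pos ho)
  · exact (hnext n).trans (if_neg (eq_other_iff.1 ho))

theorem disjoint_winSet (G : ParityGame V) (i : Fin 2) :
    Disjoint (G.winSet i) (G.winSet (other i)) := by
  rw [Set.disjoint_left]
  rintro v ⟨hv, σ, hσ, hσw⟩ ⟨-, τ, hτ, hτw⟩
  obtain ⟨f, h0, hp, hcσ, hcτ⟩ := exists_play hσ hτ hv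
  exact not_winsPlay_other (hσw f h0 hp hcσ) (hτw f h0 hp hcτ)

/-- A play consistent with a winning strategy of player `i` never gives that strategy the
occasion to move into the winning set of the opponent. -/
theorem strategy_notMem_winSet_other (hG : G.Proper) {σ : Strategy V} (hσ : ValidStrategy G i σ)
    (hσw : ∀ f : ℕ → V, f 0 = v → IsPlay G f → Consistent G i σ f → WinsPlay G i f)
    {f : ℕ → V} (h0 : f 0 = v) (hf : IsPlay G f) {n : ℕ}
    (hc : ∀ k < n, G.owner (f k) = i → f (k + 1) = σ (List.ofFn fun l : Fin k => f l) (f k))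
    (ho : G.owner (f n) = i) :
    σ (List.ofFn fun l : Fin n => f l) (f n) ∉ G.winSet (other i) := by
  intro hmem
  obtain ⟨ρ, hρ, hρf⟩ := hG.exists_strategy (other i) fun h _ => f (h.length + 1)
  obtain ⟨ρ', hρ', hsw⟩ := exists_switch_strategy (suffixClosed_winsPlay G (other i)) hρ
    (T := G.winSet (other i)) fun w hw => hw.2
  obtain ⟨g, hg0, hgp, hgσ, hgρ'⟩ := exists_play hσ hρ' (h0 ▸ hf.mem_nodes 0)
  obtain ⟨hgρ, hgT⟩ :=
    (hsw g hgp hgρ').resolve_left (not_winsPlay_other (hσw g hg0 hgp hgσ))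
  have hist : ∀ k, (∀ l < k, g l = f l) →
      (List.ofFn fun l : Fin k => g l) = List.ofFn fun l : Fin k => f l :=
    fun k h => congrArg List.ofFn (funext fun l => h l l.2)
  have hgf : ∀ k ≤ n, g k = f k := by
    intro k
    induction k using Nat.strong_induction_on with
    | _ k ih =>
      intro hk
      cases k with
      | zero => rw [hg0, h0]
      | succ k =>
        have hgk : g k = f k := ih k (by omega) (by omega)
        have hh := hist k fun l hl => ih l (by omega) (by omega)
        by_cases hok : G.owner (f k) = i
        · rw [hgσ k (hgk ▸ hok), hh, hgk, hc k (by omega) hok]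
        · rw [hgρ k (hgk ▸ eq_other_iff.2 hok), hh, hgk, hρf _ _ (by simpa using hf k)]
          simp
  refine hgT (n + 1) ?_
  rw [hgσ n (hgf n le_rfl ▸ ho), hist n fun l hl => hgf l hl.le, hgf n le_rfl]
  exact hmem

theorem mem_reach_iff (hG : G.Proper) {A : Set V} (hA : A ⊆ G.nodes) :
    v ∈ G.reach i A ↔ v ∈ G.nodes ∧ Forces G i (fun f => ∃ n, f n ∈ A) v := by
  refine ⟨?_, Or.inr⟩
  rintro (hv | hv)
  · obtain ⟨σ, hσ, -⟩ := hG.exists_strategy i fun _ u => u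
    exact ⟨hA hv, σ, hσ, fun f h0 _ _ => ⟨0, h0 ▸ hv⟩⟩
  · exact hv

theorem mem_reach_of_edge (hG : G.Proper) {A : Set V} (hA : A ⊆ G.nodes) (ho : G.owner v = i)
    (he : G.edge v w) (hw : w ∈ G.reach i A) : v ∈ G.reach i A :=
  (mem_reach_iff hG hA).2 ⟨(G.edge_mem _ _ he).1,
    .of_edge hG (suffixClosed_hits A) ho he ((mem_reach_iff hG hA).1 hw).2⟩

theorem exists_edge_notMem_reach (hG : G.Proper) {A : Set V} (hA : A ⊆ G.nodes)
    (hv : v ∈ G.nodes) (hvA : v ∉ G.reach i A) : ∃ w, G.edge v w ∧ w ∉ G.reach i A := by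
  by_contra! h
  exact hvA ((mem_reach_iff hG hA).2 ⟨hv, .of_forall_edge hG (suffixClosed_hits A)
    fun w hw => ((mem_reach_iff hG hA).1 (h w hw)).2⟩)

theorem reach_subset_winSet (hG : G.Proper) {A : Set V} (hA : A ⊆ G.winSet i) :
    G.reach i A ⊆ G.winSet i := by
  intro v hv
  obtain ⟨hv, σ, hσ, hσA⟩ := (mem_reach_iff hG (hA.trans fun _ h => h.1)).1 hv
  obtain ⟨σ', hσ', hf⟩ := exists_switch_strategy (suffixClosed_winsPlay G i) hσ
    (T := A) fun w hw => (hA hw).2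
  refine ⟨hv, σ', hσ', fun f h0 hp hc => (hf f hp hc).resolve_right fun ⟨hc', hT⟩ => ?_⟩
  obtain ⟨n, hn⟩ := hσA f h0 hp hc'
  exact hT n hn

/-- A strategy of a sub-game extends to the whole game. -/
theorem ValidStrategy.exists_extension (hG : G.Proper) {B : Set V} {σ : Strategy V}
    (hσ : ValidStrategy (G.sub B) i σ) :
    ∃ τ : Strategy V, ValidStrategy G i τ ∧
      ∀ h u, u ∈ G.nodes → G.owner u = i → u ∉ B → τ h u = σ h u := by
  obtain ⟨τ, hτ, hτσ⟩ := hG.exists_strategy i σ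
  exact ⟨τ, hτ, fun h u hu ho huB => hτσ h u (hσ h u ⟨hu, huB⟩ ho).1⟩

theorem IsPlay.sub {f : ℕ → V} (hf : IsPlay G f) {B : Set V} (hB : ∀ n, f n ∉ B) :
    IsPlay (G.sub B) f :=
  fun n => ⟨hf n, hB n, hB (n + 1)⟩

theorem IsPlay.of_sub {f : ℕ → V} {B : Set V} (hf : IsPlay (G.sub B) f) : IsPlay G f :=
  fun n => (hf n).1

theorem winSet_sub_subset (hG : G.Proper) {B : Set V} (hB : B ⊆ G.winSet i) :
    (G.sub B).winSet i ⊆ G.winSet i := by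
  rintro v ⟨hv, σ, hσ, hσw⟩
  obtain ⟨τ, hτ, hτσ⟩ := hσ.exists_extension hG
  obtain ⟨τ', hτ', hf⟩ := exists_switch_strategy (suffixClosed_winsPlay G i) hτ
    (T := B) fun w hw => (hB hw).2
  refine ⟨hv.1, τ', hτ', fun f h0 hp hc => (hf f hp hc).elim id fun ⟨hc', hT⟩ => ?_⟩
  exact hσw f h0 (hp.sub hT) fun n ho =>
    (hc' n ho).trans (hτσ _ _ (hp.mem_nodes n) ho (hT n))

theorem winSet_sub_subset_of_other_trapped (hG : G.Proper) {B : Set V}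
    (hB : ∀ u w, G.owner u = other i → G.edge u w → w ∈ B → u ∈ B) :
    (G.sub B).winSet i ⊆ G.winSet i := by
  rintro v ⟨hv, σ, hσ, hσw⟩
  obtain ⟨τ, hτ, hτσ⟩ := hσ.exists_extension hG
  refine ⟨hv.1, τ, hτ, fun f h0 hp hc => ?_⟩
  have hT : ∀ n, f n ∉ B := by
    intro n
    induction n with
    | zero => exact h0 ▸ hv.2
    | succ n ih =>
      by_cases ho : G.owner (f n) = i
      · rw [hc n ho, hτσ _ _ (hp.mem_nodes n) ho ih]
        exact (hσ _ _ ⟨hp.mem_nodes n, ih⟩ ho).2.2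
      · exact fun h => ih (hB _ _ (eq_other_iff.2 ho) (hp n) h)
  exact hσw f h0 (hp.sub hT) fun n ho =>
    (hc n ho).trans (hτσ _ _ (hp.mem_nodes n) ho (hT n))

theorem winSet_diff_subset_sub {B : Set V}
    (hB : ∀ u w, G.owner u = i → G.edge u w → w ∈ B → u ∈ B) :
    G.winSet i \ B ⊆ (G.sub B).winSet i := by
  rintro v ⟨⟨hv, σ, hσ, hσw⟩, hvB⟩
  refine ⟨⟨hv, hvB⟩, σ, fun h u hu ho => ?_, fun f h0 hp hc => hσw f h0 hp.of_sub hc⟩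
  have he := hσ h u hu.1 ho
  exact ⟨he, hu.2, fun h => hu.2 (hB _ _ ho he h)⟩

theorem winSet_subset_sub (hG : G.Proper) {B : Set V} (hB : B ⊆ G.winSet (other i))
    (hex : ∀ u ∈ G.nodes, u ∉ B → ∃ w, G.edge u w ∧ w ∉ B) :
    G.winSet i ⊆ (G.sub B).winSet i := by
  classical
  intro v hvi
  have hvB : v ∉ B := fun h => (disjoint_winSet G i).le_bot ⟨hvi, hB h⟩
  obtain ⟨hv, σ, hσ, hσw⟩ := hvi
  have hsub : (G.sub B).Proper := fun u hu =>
    let ⟨w, he, hw⟩ := hex u hu.1 hu.2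
    ⟨w, he, hu.2, hw⟩
  obtain ⟨τ, hτ, hτσ⟩ := hsub.exists_strategy i σ
  refine ⟨⟨hv, hvB⟩, τ, hτ, fun f h0 hp hc => hσw f h0 hp.of_sub fun n => ?_⟩
  induction n using Nat.strong_induction_on with
  | _ n ih =>
    intro ho
    have hn := strategy_notMem_winSet_other hG hσ hσw h0 hp.of_sub ih ho
    exact (hc n ho).trans (hτσ _ _
      ⟨hσ _ _ (hp.of_sub.mem_nodes n) ho, (hp.mem_nodes n).2, fun h => hn (hB h)⟩)

end ParityGame

/-- If `U ⊆ win_{¬i}(G)` and `U* = reach_{¬i}(U)`, then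
`win_{¬i}(G) = U* ∪ win_{¬i}(G − U*)` and `win_i(G) = win_i(G − U*)`. -/
theorem winSet_reach_decomp {V : Type} (G : ParityGame V) (hG : G.Proper) (i : Fin 2)
    (U Ustar : Set V) (hU : U ⊆ G.winSet (ParityGame.other i))
    (hUstar : Ustar = G.reach (ParityGame.other i) U) :
    G.winSet (ParityGame.other i)
        = Ustar ∪ (G.sub Ustar).winSet (ParityGame.other i) ∧
      G.winSet i = (G.sub Ustar).winSet i := by
  subst hUstar
  have hUn : U ⊆ G.nodes := hU.trans fun _ h => h.1
  have hwin := ParityGame.reach_subset_winSet hG hU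
  have hedge : ∀ u w, G.owner u = ParityGame.other i → G.edge u w →
      w ∈ G.reach (ParityGame.other i) U → u ∈ G.reach (ParityGame.other i) U :=
    fun _ _ ho he => ParityGame.mem_reach_of_edge hG hUn ho he
  refine ⟨Set.Subset.antisymm ?_ (Set.union_subset hwin (ParityGame.winSet_sub_subset hG hwin)),
    Set.Subset.antisymm ?_ (ParityGame.winSet_sub_subset_of_other_trapped hG hedge)⟩
  · exact Set.sdiff_subset_iff.1 (ParityGame.winSet_diff_subset_sub hedge)
  · exact ParityGame.winSet_subset_sub hG hwin fun _ hu =>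
      ParityGame.exists_edge_notMem_reach hG hUn hu
end

section
/- Let G = (V₀ ⊎ V₁, E, p) be a bipartite parity game with |V₁| = k and p distinct priorities satisfying: (i) every node of G has at least one in-neighbor; (ii) for all distinct u, v ∈ V₀ with N⁺_G(v) ⊆ N⁺_G(u) and p₁(v) ≥ p₁(u), it holds that N⁻_G(u) ∩ N⁻_G(v) = ∅; and (iii) there are no distinct u, v ∈ V₀ with N⁺_G(u) = N⁺_G(v) and p(u) = p(v). Then |V₀| ≤ 2^k · min{k, p}. -/
universe u

namespace ParityGame

/-- If, among player-`0` nodes, the out-neighborhood of a node together with a label from a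
finite set `S` determines the node, then there are at most `2 ^ |V₁| * |S|` such nodes. -/
lemma ncard_playerNodes_zero_le {V : Type*} {α : Type*} (G : ParityGame V) (hbip : G.Bipartite)
    (f : V → α) {S : Set α} (hS : S.Finite) (hf : ∀ v ∈ G.playerNodes 0, f v ∈ S)
    (hinj : ∀ u ∈ G.playerNodes 0, ∀ v ∈ G.playerNodes 0,
      (∀ w, G.edge u w ↔ G.edge v w) → f u = f v → u = v) :
    (G.playerNodes 0).ncard ≤ 2 ^ (G.playerNodes 1).ncard * S.ncard := by
  have hfin : (G.playerNodes 1).Finite := G.finite.subset fun _ h => h.1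
  rw [← Set.ncard_powerset _ hfin, ← Set.ncard_prod]
  refine Set.ncard_le_ncard_of_injOn (fun v => ({w | G.edge v w}, f v)) ?_ ?_
    (hfin.finite_subsets.prod hS)
  · intro v hv
    refine ⟨fun w hw => ⟨(G.edge_mem v w hw).2, ?_⟩, hf v hv⟩
    have hne := hbip v w hw
    rw [hv.2] at hne
    omega
  · intro u hu v hv h
    obtain ⟨hN, hp⟩ := Prod.mk.inj h
    exact hinj u hu v hv (fun w => Set.ext_iff.mp hN w) hp

end ParityGame

/-- A bipartite parity game with `|V₁| = k` and `p` distinct priorities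
that is fully reduced — (i) every node has an in-neighbor, (ii) distinct `u,v ∈ V₀`
with `N⁺(v) ⊆ N⁺(u)` and `p₁(v) ≥ p₁(u)` have disjoint in-neighborhoods, and
(iii) no two distinct nodes of `V₀` have equal out-neighborhoods and equal
priorities — satisfies `|V₀| ≤ 2^k · min{k, p}`. -/
theorem kernel_size {V : Type} (G : ParityGame V) (hG : G.Proper) (hbip : G.Bipartite)
    (hin : ∀ v ∈ G.nodes, ∃ w, G.edge w v)
    (h2 : ∀ u v, u ∈ G.playerNodes 0 → v ∈ G.playerNodes 0 → u ≠ v →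
      (∀ w, G.edge v w → G.edge u w) → G.p1 u ≤ G.p1 v →
      ∀ w, ¬(G.edge w u ∧ G.edge w v))
    (h3 : ∀ u v, u ∈ G.playerNodes 0 → v ∈ G.playerNodes 0 → u ≠ v →
      ¬((∀ w, G.edge u w ↔ G.edge v w) ∧ G.priority u = G.priority v)) :
    (G.playerNodes 0).ncard ≤ 2 ^ (G.playerNodes 1).ncard *
      min (G.playerNodes 1).ncard (G.priority '' G.nodes).ncard := by
  have hex : ∀ v, ∃ w, v ∈ G.nodes → G.edge w v := fun v => by
    by_cases hv : v ∈ G.nodes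
    · exact (hin v hv).imp fun _ h _ => h
    · exact ⟨v, fun h => absurd h hv⟩
  choose pred hpred using hex
  rw [← Nat.mul_min_mul_left]
  refine le_min ?_ ?_
  · refine G.ncard_playerNodes_zero_le hbip pred (G.finite.subset fun _ h => h.1) ?_ ?_
    · intro v hv
      have he := hpred v hv.1
      have hne := hbip _ _ he
      rw [hv.2] at hne
      exact ⟨(G.edge_mem _ _ he).1, by omega⟩
    · intro u hu v hv hN hp
      by_contra hne
      have hu' := hpred u hu.1
      have hv' := hpred v hv.1
      rw [← hp] at hv'
      rcases le_total (G.p1 u) (G.p1 v) with h | h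
      · exact h2 u v hu hv hne (fun w => (hN w).2) h _ ⟨hu', hv'⟩
      · exact h2 v u hv hu (Ne.symm hne) (fun w => (hN w).1) h _ ⟨hv', hu'⟩
  · refine G.ncard_playerNodes_zero_le hbip G.priority (G.finite.image _)
      (fun v hv => Set.mem_image_of_mem _ hv.1) fun u hu v hv hN hp => ?_
    by_contra hne
    exact h3 u v hu hv hne ⟨hN, hp⟩
end

section
/- Let f : ℕ → ℕ be defined by f(n) = n ∸ ⌈√(2n)⌉ (truncated subtraction). Then for every natural number k, the ⌊√(2k)⌋-fold iterate of f applied to k satisfies f^[⌊√(2k)⌋](k) ≤ 4. -/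
universe u

theorem iterate_eq_zero_of_two_mul_le {f : ℕ → ℕ}
    (hf : ∀ n, f n = n - (⌈Real.sqrt (2 * (n : ℝ))⌉).toNat) (m : ℕ) :
    ∀ n : ℕ, 2 * n ≤ m * (m + 2) → f^[m] n = 0 := by
  induction m with
  | zero => intro n hn; simpa using hn
  | succ m ih =>
    intro n hn
    rw [Function.iterate_succ_apply]
    apply ih
    rw [hf, Int.ceil_toNat]
    have hc : 2 * n ≤ ⌈Real.sqrt (2 * (n : ℝ))⌉₊ ^ 2 := by
      have h := (Real.sqrt_le_left (Nat.cast_nonneg _)).1 (Nat.le_ceil (Real.sqrt (2 * (n : ℝ))))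
      exact_mod_cast h
    generalize ⌈Real.sqrt (2 * (n : ℝ))⌉₊ = c at hc ⊢
    rcases le_total n c with h | h
    · simp [Nat.sub_eq_zero_of_le h]
    · obtain ⟨d, rfl⟩ := Nat.exists_eq_add_of_le h
      rw [Nat.add_sub_cancel_left]
      rcases Nat.lt_or_ge c (m + 2) with h' | h' <;> nlinarith

/-- With `f(n) = n ∸ ⌈√(2n)⌉` (truncated subtraction on `ℕ`), the
`⌊√(2k)⌋`-fold iterate of `f` applied to `k` is at most `4`. -/
theorem iterate_sqrt_le_four (f : ℕ → ℕ)
    (hf : ∀ n, f n = n - (⌈Real.sqrt (2 * (n : ℝ))⌉).toNat) (k : ℕ) :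
    f^[(⌊Real.sqrt (2 * (k : ℝ))⌋).toNat] k ≤ 4 := by
  refine (iterate_eq_zero_of_two_mul_le hf _ k ?_).trans_le (Nat.zero_le 4)
  rw [Int.floor_toNat]
  have h : 2 * k < (⌊Real.sqrt (2 * (k : ℝ))⌋₊ + 1) ^ 2 := by
    have h := (Real.sqrt_lt' (by positivity)).1 (Nat.lt_floor_add_one (Real.sqrt (2 * (k : ℝ))))
    exact_mod_cast h
  nlinarith
end

section
/- Let D ≥ 0 be a real number and let T : ℕ × ℕ → ℝ be such that T(k, p) ≥ 0 for all k, p; T(k, p) ≤ D whenever k ≤ 4; T(k, 0) ≤ D for all k; and for all k ≥ 5 and p ≥ 1, T(k, p) ≤ max{T(k − 1, p), T(k, p − 1) + T(k − ⌈√(2k)⌉, p)} + D. Then T(k, p) ≤ 2(k + p)^{⌊√(2k)⌋} · D for all k, p ∈ ℕ. -/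
universe u

theorem sqrt_two_mul_sub_lt {k c : ℕ} (hk : 0 < k) (hc : 2 * k ≤ c ^ 2) :
    Nat.sqrt (2 * (k - c)) < Nat.sqrt (2 * k) := by
  rw [Nat.lt_iff_add_one_le, Nat.le_sqrt']
  set s := Nat.sqrt (2 * (k - c)) with hs
  have h1 : s ^ 2 ≤ 2 * (k - c) := Nat.sqrt_le' _
  rcases le_total k c with h | h
  · have : s = 0 := by simp [hs, Nat.sub_eq_zero_of_le h]
    rw [this]
    omega
  · have hc0 : 0 < c := by
      rcases Nat.eq_zero_or_pos c with rfl | h0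
      · omega
      · exact h0
    have hsc : s < c := lt_of_pow_lt_pow_left₀ 2 c.zero_le (by omega)
    have : (s + 1) ^ 2 = s ^ 2 + 2 * s + 1 := by ring
    omega

theorem pow_add_pow_add_one_le {m n r e : ℕ} (hm : 0 < m) (hmn : m ≤ n) (hr : 2 ≤ r)
    (he : e < r) : n ^ r + m ^ e + 1 ≤ (n + 1) ^ r := by
  obtain ⟨q, rfl⟩ : ∃ q, r = q + 1 := ⟨r - 1, by omega⟩
  have h1 : m ^ e ≤ n ^ q :=
    (Nat.pow_le_pow_right hm (by omega)).trans (Nat.pow_le_pow_left hmn q)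
  have h2 : n ^ q < (n + 1) ^ q := Nat.pow_lt_pow_left (by omega) (by omega)
  have h3 : n * n ^ q ≤ n * (n + 1) ^ q := Nat.mul_le_mul_left n h2.le
  have h4 : n ^ (q + 1) = n * n ^ q := pow_succ' n q
  have h5 : (n + 1) ^ (q + 1) = n * (n + 1) ^ q + (n + 1) ^ q := by ring
  omega

/-- The recurrence governing `new-win₁` on general parity games:
if `T(k,p) ≤ D` for `k ≤ 4` and for `p = 0`, and
`T(k,p) ≤ max{T(k−1,p), T(k,p−1) + T(k−⌈√(2k)⌉,p)} + D` for `k ≥ 5`, `p ≥ 1`,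
then `T(k,p) ≤ 2(k+p)^{⌊√(2k)⌋}·D` for all `k, p`. -/
theorem recurrence_general (D : ℝ) (hD : 0 ≤ D) (T : ℕ → ℕ → ℝ)
    (hpos : ∀ k p, 0 ≤ T k p)
    (hbase : ∀ k p, k ≤ 4 → T k p ≤ D)
    (hbase0 : ∀ k, T k 0 ≤ D)
    (hrec : ∀ k p, 5 ≤ k → 1 ≤ p →
      T k p ≤ max (T (k - 1) p)
          (T k (p - 1) + T (k - (⌈Real.sqrt (2 * (k : ℝ))⌉).toNat) p) + D) :
    ∀ k p, T k p ≤ 2 * (((k + p) ^ (⌊Real.sqrt (2 * (k : ℝ))⌋).toNat : ℕ) : ℝ) * D := by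
  have hfloor : ∀ k : ℕ, (⌊Real.sqrt (2 * (k : ℝ))⌋).toNat = Nat.sqrt (2 * k) := by
    intro k
    have h := Real.floor_real_sqrt_eq_nat_sqrt (a := 2 * k)
    push_cast at h
    rw [h, Int.toNat_natCast]
  have hbound : ∀ N : ℕ, 1 ≤ N → D ≤ 2 * (N : ℝ) * D := by
    intro N hN
    have hN' : (1 : ℝ) ≤ N := by exact_mod_cast hN
    nlinarith
  suffices h : ∀ n k p, k + p = n →
      T k p ≤ 2 * (((k + p) ^ Nat.sqrt (2 * k) : ℕ) : ℝ) * D by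
    intro k p
    rw [hfloor]
    exact h _ k p rfl
  intro n
  induction n using Nat.strong_induction_on with
  | _ n ih =>
  intro k p hn
  have hone : 1 ≤ (k + p) ^ Nat.sqrt (2 * k) := by
    rcases Nat.eq_zero_or_pos k with rfl | h0
    · simp
    · exact Nat.one_le_pow _ _ (by omega)
  rcases Nat.lt_or_ge k 5 with hk | hk
  · exact (hbase k p (by omega)).trans (hbound _ hone)
  rcases Nat.eq_zero_or_pos p with rfl | hp
  · exact (hbase0 k).trans (hbound _ hone)
  refine (hrec k p hk hp).trans ?_
  set c := (⌈Real.sqrt (2 * (k : ℝ))⌉).toNat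
  have hc : 2 * k ≤ c ^ 2 := by
    have h1 : Real.sqrt (2 * (k : ℝ)) ≤ (c : ℝ) :=
      (Int.le_ceil _).trans (Int.cast_le.2 (Int.self_le_toNat _))
    have h2 := (Real.sqrt_le_left (Nat.cast_nonneg c)).1 h1
    exact_mod_cast h2
  have hc0 : 0 < c := by
    rcases Nat.eq_zero_or_pos c with h0 | h0
    · rw [h0] at hc
      omega
    · exact h0
  have hr : 2 ≤ Nat.sqrt (2 * k) := by
    rw [Nat.le_sqrt']
    omega
  obtain ⟨m, rfl⟩ : ∃ m, n = m + 1 := ⟨n - 1, by omega⟩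
  have h1 := ih m (by omega) (k - 1) p (by omega)
  have h2 := ih m (by omega) k (p - 1) (by omega)
  have h3 := ih (k - c + p) (by omega) (k - c) p rfl
  rw [show k - 1 + p = m by omega] at h1
  rw [show k + (p - 1) = m by omega] at h2
  rw [hn]
  have key : m ^ Nat.sqrt (2 * k) + (k - c + p) ^ Nat.sqrt (2 * (k - c)) + 1 ≤
      (m + 1) ^ Nat.sqrt (2 * k) :=
    pow_add_pow_add_one_le (by omega) (by omega) hr (sqrt_two_mul_sub_lt (by omega) hc)
  have hle : m ^ Nat.sqrt (2 * (k - 1)) ≤ m ^ Nat.sqrt (2 * k) :=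
    Nat.pow_le_pow_right (by omega) (Nat.sqrt_le_sqrt (by omega))
  have key' := mul_le_mul_of_nonneg_right (Nat.cast_le (α := ℝ).2 key) hD
  have hle' := mul_le_mul_of_nonneg_right (Nat.cast_le (α := ℝ).2 hle) hD
  have hnn : 0 ≤ (((k - c + p) ^ Nat.sqrt (2 * (k - c)) : ℕ) : ℝ) * D :=
    mul_nonneg (Nat.cast_nonneg _) hD
  rw [Nat.cast_add, Nat.cast_add, Nat.cast_one, add_mul, add_mul, one_mul] at key'
  rw [← le_sub_iff_add_le]
  apply max_le <;> linarith
end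

section
/- Let c₁' > 0 and c' > 0 be real constants and let T : ℕ × ℕ → ℝ be nonnegative and satisfy: T(ℓ, q) ≤ c' · (q + ℓ)^{8⌊√(2ℓ)⌋} for all ℓ ≤ 4 and all q ≥ 1, and T(k, p) ≤ 2 c₁' (k + p)^{⌊√(2k)⌋} · k^{⌊√(2k)⌋} · T(⌊√(2k)⌋, p) for all k ≥ 5 and all p ≥ 1. Then there exist constants c₁ ≥ c' and c₂ ≥ 8 such that T(k, p) ≤ c₁ · (p + k)^{c₂ ⌊√(2k)⌋} for all k ∈ ℕ and all p ≥ 1. -/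
universe u

theorem toNat_floor_real_sqrt_two_mul (k : ℕ) :
    (⌊Real.sqrt (2 * (k : ℝ))⌋).toNat = Nat.sqrt (2 * k) := by
  have h : (2 * (k : ℝ)) = ((2 * k : ℕ) : ℝ) := by push_cast; rfl
  rw [h, Real.floor_real_sqrt_eq_nat_sqrt, Int.toNat_natCast]

theorem three_mul_sqrt_two_mul_le {s : ℕ} (hs : 3 ≤ s) :
    3 * Nat.sqrt (2 * s) ≤ 2 * s := by
  have h := Nat.sqrt_le (2 * s)
  by_contra! hlt
  rcases Nat.lt_or_ge s 5 with h5 | h5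
  · have h3 : 3 ≤ Nat.sqrt (2 * s) := by omega
    interval_cases s
    · nlinarith
    · nlinarith
  · nlinarith

theorem sqrt_two_mul_lt {k : ℕ} (hk : 5 ≤ k) : Nat.sqrt (2 * k) < k :=
  Nat.sqrt_lt.2 (by nlinarith)

theorem three_le_sqrt_two_mul {k : ℕ} (hk : 5 ≤ k) : 3 ≤ Nat.sqrt (2 * k) :=
  Nat.le_sqrt.2 (by omega)

/-- Resolving the recurrence for general parity games: if
`T(ℓ,q) ≤ c'·(q+ℓ)^{8⌊√(2ℓ)⌋}` for `ℓ ≤ 4`, `q ≥ 1`, and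
`T(k,p) ≤ 2c₁'(k+p)^{⌊√(2k)⌋}·k^{⌊√(2k)⌋}·T(⌊√(2k)⌋,p)` for `k ≥ 5`, `p ≥ 1`,
then there are constants `c₁ ≥ c'` and `c₂ ≥ 8` with
`T(k,p) ≤ c₁·(p+k)^{c₂⌊√(2k)⌋}` for all `k` and all `p ≥ 1`. -/
theorem resolve_recurrence_general (c₁' c' : ℝ) (hc₁' : 0 < c₁') (hc' : 0 < c')
    (T : ℕ → ℕ → ℝ) (hpos : ∀ k p, 0 ≤ T k p)
    (hbase : ∀ l q, l ≤ 4 → 1 ≤ q →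
      T l q ≤ c' * (((q + l) ^ (8 * (⌊Real.sqrt (2 * (l : ℝ))⌋).toNat) : ℕ) : ℝ))
    (hrec : ∀ k p, 5 ≤ k → 1 ≤ p →
      T k p ≤ 2 * c₁' * (((k + p) ^ (⌊Real.sqrt (2 * (k : ℝ))⌋).toNat : ℕ) : ℝ)
        * ((k ^ (⌊Real.sqrt (2 * (k : ℝ))⌋).toNat : ℕ) : ℝ)
        * T (⌊Real.sqrt (2 * (k : ℝ))⌋).toNat p) :
    ∃ (c₁ : ℝ) (c₂ : ℕ), c' ≤ c₁ ∧ 8 ≤ c₂ ∧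
      ∀ k p, 1 ≤ p →
        T k p ≤ c₁ * (((p + k) ^ (c₂ * (⌊Real.sqrt (2 * (k : ℝ))⌋).toNat) : ℕ) : ℝ) := by
  simp only [toNat_floor_real_sqrt_two_mul] at hbase hrec ⊢
  push_cast at hbase hrec ⊢
  obtain ⟨C, hC⟩ := pow_unbounded_of_one_lt (2 * c₁') (one_lt_two : (1 : ℝ) < 2)
  refine ⟨c', 3 * (C + 3), le_rfl, by omega, fun k => ?_⟩
  induction k using Nat.strong_induction_on with
  | _ k ih =>
    intro p hp
    have hp' : (1 : ℝ) ≤ p := by exact_mod_cast hp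
    rcases Nat.lt_or_ge k 5 with hk | hk
    · refine (hbase k p (by omega) hp).trans ?_
      have hN : (1 : ℝ) ≤ p + k := le_add_of_le_of_nonneg hp' k.cast_nonneg
      gcongr
      omega
    · have hs := three_le_sqrt_two_mul hk
      have hlt := sqrt_two_mul_lt hk
      have hrec' := hrec k p hk hp
      have ih' := ih _ hlt p hp
      have hgap := three_mul_sqrt_two_mul_le hs
      set s := Nat.sqrt (2 * k)
      set m := Nat.sqrt (2 * s)
      have hk' : (5 : ℝ) ≤ k := by exact_mod_cast hk
      have hsk : (s : ℝ) ≤ k := by exact_mod_cast hlt.le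
      have hN : (2 : ℝ) ≤ p + k := by linarith
      have hexp : C + s + s + 3 * (C + 3) * m ≤ 3 * (C + 3) * s := by nlinarith
      calc T k p ≤ 2 * c₁' * (k + p : ℝ) ^ s * (k : ℝ) ^ s * T s p := hrec'
        _ ≤ (p + k : ℝ) ^ C * (p + k : ℝ) ^ s * (p + k : ℝ) ^ s *
            (c' * (p + k : ℝ) ^ (3 * (C + 3) * m)) := by
          have hconst : 2 * c₁' ≤ (p + k : ℝ) ^ C :=
            hC.le.trans (pow_le_pow_left₀ zero_le_two hN C)
          have hT : T s p ≤ c' * (p + k : ℝ) ^ (3 * (C + 3) * m) :=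
            ih'.trans (by gcongr)
          have hkN : (k : ℝ) ≤ p + k := by linarith
          rw [add_comm (k : ℝ) p]
          have := hpos s p
          gcongr
        _ = c' * (p + k : ℝ) ^ (C + s + s + 3 * (C + 3) * m) := by
          simp only [pow_add]
          ring
        _ ≤ c' * (p + k : ℝ) ^ (3 * (C + 3) * s) := by
          gcongr
          linarith
end
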